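/- Let a, b, c, q ∈ ℂ with q ≠ 0. Assume none of 1+a−b, 1+a−c, q is a nonpositive integer. Let x be a real number with −1 < x < 3 − 2√2, set δ = (q+(a−q)x)/(1+x), and assume δ is not a nonpositive integer. Then (both series converging absolutely, since |x| < 1 and 4|x| < (1−x)²): ₄F₃(a, b, c, q+1; 1+a−b, 1+a−c, q; x) = (1 + ((a−q)/q)x) · (1−x)^{−a−1} · ₄F₃(a/2, (a+1)/2, 1+a−b−c, δ+1; 1+a−b, 1+a−c, δ; −4x/(1−x)²). -/

import Mathlib

/-- Rising factorial (Pochhammer symbol) `(a)ₖ = a(a+1)⋯(a+k−1)`. -/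
noncomputable def poch (a : ℂ) (k : ℕ) : ℂ := (ascPochhammer ℂ k).eval a

/-- The hypergeometric series `ₘFₗ(A; B; x)` (as a `tsum`). -/
noncomputable def hypF (A B : List ℂ) (x : ℂ) : ℂ :=
  ∑' k : ℕ, (A.map fun a => poch a k).prod /
      ((k.factorial : ℂ) * (B.map fun b => poch b k).prod) * x ^ k

/-- Absolute convergence (= summability in `ℂ`) of the hypergeometric series. -/
def hypSummable (A B : List ℂ) (x : ℂ) : Prop :=
  Summable fun k : ℕ => (A.map fun a => poch a k).prod /
      ((k.factorial : ℂ) * (B.map fun b => poch b k).prod) * x ^ k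

open Filter Topology Finset

theorem poch_zero (a : ℂ) : poch a 0 = 1 := by simp [poch]

theorem poch_succ (a : ℂ) (k : ℕ) : poch a (k + 1) = poch a k * (a + k) :=
  ascPochhammer_succ_eval k a

theorem poch_ne_zero {a : ℂ} (ha : ∀ m : ℕ, a ≠ -(m : ℂ)) (k : ℕ) : poch a k ≠ 0 := by
  induction k with
  | zero => simp [poch_zero]
  | succ k ih =>
    rw [poch_succ]
    exact mul_ne_zero ih fun h => ha k (eq_neg_of_add_eq_zero_left h)

theorem poch_add (a : ℂ) (m n : ℕ) : poch a (m + n) = poch a m * poch (a + m) n := by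
  induction n with
  | zero => simp [poch_zero]
  | succ n ih =>
    rw [← add_assoc, poch_succ, ih, poch_succ]
    push_cast
    ring

theorem poch_one_add (a : ℂ) (n : ℕ) : poch a (n + 1) = a * poch (a + 1) n := by
  rw [add_comm, poch_add, poch_succ, poch_zero]
  push_cast
  ring

/-- Duplication formula for rising factorials. -/
theorem poch_two_mul (a : ℂ) (k : ℕ) :
    poch a (2 * k) = 4 ^ k * poch (a / 2) k * poch ((a + 1) / 2) k := by
  induction k with
  | zero => simp [poch_zero]
  | succ k ih =>
    rw [show 2 * (k + 1) = 2 * k + 1 + 1 by ring, poch_succ, poch_succ, ih, poch_succ, poch_succ]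
    push_cast
    ring

/-- The first-order recurrence behind the Pfaff–Saalschütz theorem, in telescoped form. -/
theorem saalschutz_telescope {a d e f : ℂ} (hef : e + f = a + 1 + d)
    (he : ∀ m : ℕ, e ≠ -(m : ℂ)) (hf : ∀ m : ℕ, f ≠ -(m : ℂ)) (n m : ℕ) :
    ∑ k ∈ range (m + 1), ((e + n) * (f + n) *
        ((-1) ^ k * ((n + 1).choose k : ℂ) * poch (a + n + 1) k * poch d k /
          (poch e k * poch f k)) -
      (e - d + n) * (f - d + n) *
        ((-1) ^ k * (n.choose k : ℂ) * poch (a + n) k * poch d k / (poch e k * poch f k)))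
    = (a + 1 + 2 * n) * ((-1) ^ m * (n.choose m : ℂ) * poch (a + n + 1) m * poch d (m + 1) /
        (poch e m * poch f m)) := by
  have hf' : f = a + 1 + d - e := by linear_combination hef
  induction m with
  | zero =>
    simp only [zero_add, sum_range_one, pow_zero, Nat.choose_zero_right, poch_zero, poch_succ]
    rw [hf']
    push_cast
    ring
  | succ m ih =>
    rw [sum_range_succ, ih]
    have h1 : ((n + 1).choose (m + 1) : ℂ) = n.choose m + n.choose (m + 1) := by
      rw [Nat.choose_succ_succ]; push_cast; ring
    have hm : (m : ℂ) + 1 ≠ 0 := by exact_mod_cast Nat.succ_ne_zero m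
    have h2 : (n.choose (m + 1) : ℂ) = n.choose m * (n - m) / (m + 1) := by
      rw [eq_div_iff hm]
      rcases le_or_gt m n with h | h
      · have := Nat.choose_succ_right_eq n m
        rw [← Nat.cast_sub h]
        exact_mod_cast this
      · rw [Nat.choose_eq_zero_of_lt h, Nat.choose_eq_zero_of_lt (by omega)]
        simp
    have hE := poch_ne_zero he m
    have hF := poch_ne_zero hf m
    have he' : e + m ≠ 0 := fun h => he m (eq_neg_of_add_eq_zero_left h)
    have hf'' : f + m ≠ 0 := fun h => hf m (eq_neg_of_add_eq_zero_left h)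
    rw [h1, h2, poch_one_add (a + n) m, poch_succ (a + n + 1) m, poch_succ d (m + 1),
      poch_succ e m, poch_succ f m]
    generalize poch (a + n + 1) m = P
    generalize poch d (m + 1) = D
    generalize poch e m = E at *
    generalize poch f m = F at *
    generalize (n.choose m : ℂ) = C
    push_cast
    have ha : a = e + f - 1 - d := by linear_combination -hef
    rw [ha, pow_succ]
    clear hf' ih hef ha
    field_simp
    ring

/-- The Pfaff–Saalschütz theorem. -/
theorem saalschutz {a d e f : ℂ} (hef : e + f = a + 1 + d)
    (he : ∀ m : ℕ, e ≠ -(m : ℂ)) (hf : ∀ m : ℕ, f ≠ -(m : ℂ)) (n : ℕ) :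
    ∑ k ∈ range (n + 1), (-1) ^ k * (n.choose k : ℂ) * poch (a + n) k * poch d k /
        (poch e k * poch f k)
      = poch (e - d) n * poch (f - d) n / (poch e n * poch f n) := by
  induction n with
  | zero => simp [poch_zero]
  | succ n ih =>
    have h := saalschutz_telescope hef he hf n (n + 1)
    rw [sum_sub_distrib, ← mul_sum, ← mul_sum, sum_range_succ (fun k => (-1) ^ k *
      (n.choose k : ℂ) * poch (a + n) k * poch d k / (poch e k * poch f k)) (n + 1), ih] at h
    simp only [Nat.choose_succ_self, Nat.cast_zero, mul_zero, zero_mul, zero_div, add_zero,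
      sub_eq_zero] at h
    have hE := poch_ne_zero he n
    have hF := poch_ne_zero hf n
    have he' : e + n ≠ 0 := fun h => he n (eq_neg_of_add_eq_zero_left h)
    have hf' : f + n ≠ 0 := fun h => hf n (eq_neg_of_add_eq_zero_left h)
    rw [show a + ((n + 1 : ℕ) : ℂ) = a + n + 1 by push_cast; ring]
    apply mul_left_cancel₀ (mul_ne_zero he' hf')
    rw [h, poch_succ, poch_succ, poch_succ, poch_succ]
    field_simp

/-- The term of a `₃F₂` series without the power of the variable. -/
noncomputable def coeffThreeTwo (α β γ e f : ℂ) (k : ℕ) : ℂ :=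
  poch α k * poch β k * poch γ k / (k.factorial * poch e k * poch f k)

theorem whipple_coeff (a b c : ℂ) (he : ∀ m : ℕ, 1 + a - b ≠ -(m : ℂ))
    (hf : ∀ m : ℕ, 1 + a - c ≠ -(m : ℂ)) (n : ℕ) :
    ∑ p ∈ antidiagonal n, coeffThreeTwo (a / 2) ((a + 1) / 2) (1 + a - b - c)
        (1 + a - b) (1 + a - c) p.1 * (-4) ^ p.1 * (poch (a + 2 * p.1) p.2 / p.2.factorial)
      = coeffThreeTwo a b c (1 + a - b) (1 + a - c) n := by
  rw [Nat.sum_antidiagonal_eq_sum_range_succ_mk]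
  have h := saalschutz (a := a) (d := 1 + a - b - c) (by ring) he hf n
  rw [show 1 + a - b - (1 + a - b - c) = c by ring,
    show 1 + a - c - (1 + a - b - c) = b by ring] at h
  have hn : (n.factorial : ℂ) ≠ 0 := by exact_mod_cast n.factorial_ne_zero
  have hr : coeffThreeTwo a b c (1 + a - b) (1 + a - c) n = poch a n / n.factorial *
      (poch c n * poch b n / (poch (1 + a - b) n * poch (1 + a - c) n)) := by
    rw [coeffThreeTwo]
    have := poch_ne_zero he n
    have := poch_ne_zero hf n
    field_simp
  rw [hr, ← h, mul_sum]
  refine sum_congr rfl fun k hk => ?_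
  have hk : k ≤ n := Nat.lt_succ_iff.mp (mem_range.mp hk)
  have h1 : poch a n * poch (a + n) k = 4 ^ k * poch (a / 2) k * poch ((a + 1) / 2) k *
      poch (a + 2 * k) (n - k) := by
    rw [← poch_add, ← poch_two_mul, show n + k = 2 * k + (n - k) by omega, poch_add]
    push_cast
    rfl
  have h2 : (n.choose k : ℂ) * k.factorial * (n - k).factorial = n.factorial := by
    exact_mod_cast Nat.choose_mul_factorial_mul_factorial hk
  have hk' : (k.factorial : ℂ) ≠ 0 := by exact_mod_cast k.factorial_ne_zero
  have hnk : ((n - k).factorial : ℂ) ≠ 0 := by exact_mod_cast (n - k).factorial_ne_zero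
  have h3 : (n.choose k : ℂ) = n.factorial / (k.factorial * (n - k).factorial) := by
    rw [eq_div_iff (mul_ne_zero hk' hnk), ← h2]; ring
  have := poch_ne_zero he k
  have := poch_ne_zero hf k
  rw [coeffThreeTwo, h3, show (-4 : ℂ) = -1 * 4 by ring, mul_pow]
  field_simp
  linear_combination (-poch (1 + a - b - c) k) * h1

/-- A power series whose coefficient ratios tend to `1` converges in the unit disc. -/
theorem summable_of_tendsto_ratio {u r : ℕ → ℂ} (hu : ∀ k, u (k + 1) = r k * u k)
    (hr : Tendsto r atTop (𝓝 1)) {z : ℂ} (hz : ‖z‖ < 1) : Summable fun k => u k * z ^ k := by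
  obtain ⟨s, hs1, hs2⟩ := exists_between hz
  refine summable_of_ratio_norm_eventually_le hs2 ?_
  have h : Tendsto (fun k => ‖r k * z‖) atTop (𝓝 ‖z‖) := by
    simpa using (hr.mul_const z).norm
  filter_upwards [h.eventually_lt_const hs1] with k hk
  rw [hu, pow_succ, show r k * u k * (z ^ k * z) = (r k * z) * (u k * z ^ k) by ring, norm_mul]
  exact mul_le_mul_of_nonneg_right hk.le (norm_nonneg _)

theorem summable_norm_mul_pow {u : ℕ → ℂ}
    (hu : ∀ z : ℂ, ‖z‖ < 1 → Summable fun k => u k * z ^ k) {r : ℝ} (hr0 : 0 ≤ r) (hr : r < 1) :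
    Summable fun k => ‖u k‖ * r ^ k := by
  simpa [abs_of_nonneg hr0] using (hu (r : ℂ) (by simpa [abs_of_nonneg hr0] using hr)).norm

theorem norm_mul_pow_le_of_mem_ball {u : ℕ → ℂ} {r : ℝ} (k : ℕ) {w : ℂ}
    (hw : w ∈ Metric.ball (0 : ℂ) r) : ‖u k * w ^ k‖ ≤ ‖u k‖ * r ^ k := by
  rw [norm_mul, norm_pow]
  gcongr
  exact (mem_ball_zero_iff.mp hw).le

theorem differentiableOn_tsum_mul_pow {u : ℕ → ℂ}
    (hu : ∀ z : ℂ, ‖z‖ < 1 → Summable fun k => u k * z ^ k) :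
    DifferentiableOn ℂ (fun z => ∑' k, u k * z ^ k) (Metric.ball 0 1) := by
  intro z hz
  obtain ⟨r, hr1, hr2⟩ := exists_between (mem_ball_zero_iff.mp hz)
  have h := Complex.differentiableOn_tsum_of_summable_norm (F := fun k w => u k * w ^ k)
    (summable_norm_mul_pow hu ((norm_nonneg z).trans hr1.le) hr2) (fun i => by fun_prop)
    Metric.isOpen_ball (fun k w => norm_mul_pow_le_of_mem_ball k)
  exact (h.differentiableAt (Metric.isOpen_ball.mem_nhds
    (mem_ball_zero_iff.mpr hr1))).differentiableWithinAt

theorem hasSum_mul_pow_weighted {u : ℕ → ℂ}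
    (hu : ∀ z : ℂ, ‖z‖ < 1 → Summable fun k => u k * z ^ k) {z : ℂ} (hz : ‖z‖ < 1) (p : ℂ) :
    HasSum (fun k => u k * (1 + k / p) * z ^ k)
      (∑' k, u k * z ^ k + z / p * deriv (fun w => ∑' k, u k * w ^ k) z) := by
  obtain ⟨r, hr1, hr2⟩ := exists_between hz
  have h := Complex.hasSum_deriv_of_summable_norm (F := fun k w => u k * w ^ k)
    (summable_norm_mul_pow hu ((norm_nonneg z).trans hr1.le) hr2) (fun i => by fun_prop)
    Metric.isOpen_ball (fun k w => norm_mul_pow_le_of_mem_ball k)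
    (mem_ball_zero_iff.mpr hr1)
  convert (hu z hz).hasSum.add (h.mul_left (z / p)) using 2 with k
  have : deriv (fun w : ℂ => u k * w ^ k) z = u k * (k * z ^ (k - 1)) := by simp
  rw [this]
  cases k with
  | zero => simp
  | succ k =>
    rw [Nat.add_sub_cancel, pow_succ]
    ring

theorem tendsto_add_div_add (α e : ℂ) :
    Tendsto (fun k : ℕ => (α + k) / (e + k)) atTop (𝓝 1) := by
  simpa using tendsto_add_mul_div_add_mul_atTop_nhds α e (1 : ℂ) one_ne_zero

theorem summable_coeffThreeTwo (α β γ : ℂ) {e f : ℂ} (he : ∀ m : ℕ, e ≠ -(m : ℂ))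
    (hf : ∀ m : ℕ, f ≠ -(m : ℂ)) (z : ℂ) (hz : ‖z‖ < 1) :
    Summable fun k => coeffThreeTwo α β γ e f k * z ^ k := by
  refine summable_of_tendsto_ratio (r := fun k : ℕ => (α + k) / (1 + k) * ((β + k) / (e + k)) *
    ((γ + k) / (f + k))) (fun k => ?_) ?_ hz
  · have := poch_ne_zero he k
    have := poch_ne_zero hf k
    have he' : e + k ≠ 0 := fun h => he k (eq_neg_of_add_eq_zero_left h)
    have hf' : f + k ≠ 0 := fun h => hf k (eq_neg_of_add_eq_zero_left h)
    have h1 : (1 : ℂ) + k ≠ 0 := by rw [add_comm]; exact_mod_cast k.succ_ne_zero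
    have h2 : (k.factorial : ℂ) ≠ 0 := by exact_mod_cast k.factorial_ne_zero
    simp only [coeffThreeTwo, poch_succ, Nat.factorial_succ]
    push_cast
    rw [add_comm (k : ℂ) 1]
    field_simp
  · simpa using ((tendsto_add_div_add α 1).mul (tendsto_add_div_add β e)).mul
      (tendsto_add_div_add γ f)

theorem hypF_three_two (α β γ e f : ℂ) :
    hypF [α, β, γ] [e, f] = fun z => ∑' k, coeffThreeTwo α β γ e f k * z ^ k := by
  funext z
  simp [hypF, coeffThreeTwo, mul_assoc]

theorem analyticAt_hypF_three_two (α β γ : ℂ) {e f : ℂ} (he : ∀ m : ℕ, e ≠ -(m : ℂ))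
    (hf : ∀ m : ℕ, f ≠ -(m : ℂ)) {z : ℂ} (hz : ‖z‖ < 1) :
    AnalyticAt ℂ (hypF [α, β, γ] [e, f]) z := by
  rw [hypF_three_two]
  exact (differentiableOn_tsum_mul_pow (summable_coeffThreeTwo α β γ he hf)).analyticAt
    (Metric.isOpen_ball.mem_nhds (mem_ball_zero_iff.mpr hz))

/-- A `₄F₃` series with a parameter pair `p + 1; p` in terms of a `₃F₂` series. -/
theorem hasSum_four_three (α β γ : ℂ) {e f p : ℂ} (he : ∀ m : ℕ, e ≠ -(m : ℂ))
    (hf : ∀ m : ℕ, f ≠ -(m : ℂ)) (hp : ∀ m : ℕ, p ≠ -(m : ℂ)) {z : ℂ} (hz : ‖z‖ < 1) :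
    HasSum (fun k : ℕ => ([α, β, γ, p + 1].map fun a => poch a k).prod /
      ((k.factorial : ℂ) * ([e, f, p].map fun b => poch b k).prod) * z ^ k)
      (hypF [α, β, γ] [e, f] z + z / p * deriv (hypF [α, β, γ] [e, f]) z) := by
  rw [hypF_three_two]
  convert hasSum_mul_pow_weighted (summable_coeffThreeTwo α β γ he hf) hz p using 3 with k
  have hp0 : p ≠ 0 := by simpa using hp 0
  have h := (poch_one_add p k).symm.trans (poch_succ p k)
  have hpk := poch_ne_zero hp k
  have h1 : poch (p + 1) k = poch p k * (1 + k / p) := by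
    apply mul_left_cancel₀ hp0
    rw [h]
    field_simp
  simp only [List.map_cons, List.map_nil, List.prod_cons, List.prod_nil, h1, coeffThreeTwo]
  have := poch_ne_zero he k
  have := poch_ne_zero hf k
  have h2 : (k.factorial : ℂ) ≠ 0 := by exact_mod_cast k.factorial_ne_zero
  field_simp

/-- The binomial series. -/
theorem hasSum_binomial (s : ℂ) {z : ℂ} (hz : ‖z‖ < 1) :
    HasSum (fun j : ℕ => poch s j / j.factorial * z ^ j) ((1 - z) ^ (-s)) := by
  have h := (Complex.one_div_one_sub_cpow_hasFPowerSeriesOnBall_zero s).hasSum (y := z)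
    (by simpa [enorm_eq_nnnorm, ← NNReal.coe_lt_coe] using hz)
  rw [zero_add, one_div, ← Complex.cpow_neg] at h
  suffices hc : ∀ j : ℕ, poch s j / j.factorial * z ^ j = (FormalMultilinearSeries.ofScalars ℂ
      (fun n : ℕ => Ring.choose (s + n - 1) n) j) fun _ => z by
    simpa only [hc] using h
  intro j
  rw [FormalMultilinearSeries.ofScalars_apply_eq, smul_eq_mul, ← Ring.multichoose_eq]
  congr 1
  have hj := Ring.factorial_nsmul_multichoose_eq_ascPochhammer s j
  rw [Polynomial.ascPochhammer_smeval_eq_eval, nsmul_eq_mul] at hj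
  have h2 : (j.factorial : ℂ) ≠ 0 := by exact_mod_cast j.factorial_ne_zero
  rw [div_eq_iff h2, mul_comm, hj, poch]

theorem norm_poch_div_factorial_le (a : ℂ) {N : ℕ} (hN : ‖a‖ ≤ N) (k j : ℕ) :
    ‖poch (a + 2 * k) j / j.factorial‖ ≤ 2 ^ (N + 2 * k + j) := by
  have h : ∀ j, ‖poch (a + 2 * k) j‖ ≤ ((N + 2 * k).ascFactorial j : ℝ) := by
    intro j
    induction j with
    | zero => simp [poch_zero]
    | succ j ih =>
      rw [poch_succ, norm_mul, Nat.ascFactorial_succ, Nat.cast_mul, mul_comm]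
      gcongr
      calc ‖a + 2 * k + j‖ ≤ ‖a‖ + ‖(2 * k : ℂ)‖ + ‖(j : ℂ)‖ := norm_add₃_le
        _ ≤ N + 2 * k + j := by simpa using hN
        _ = _ := by push_cast; ring
  have hj : (0 : ℝ) < j.factorial := by exact_mod_cast j.factorial_pos
  rw [norm_div, Complex.norm_natCast, div_le_iff₀ hj]
  refine (h j).trans ?_
  rw [Nat.ascFactorial_eq_factorial_mul_choose', mul_comm]
  push_cast
  gcongr
  exact_mod_cast (Nat.choose_le_two_pow _ _).trans (Nat.pow_le_pow_right two_pos (by omega))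

/-- Whipple's quadratic transformation near the origin. -/
theorem whipple_of_norm_lt (a b c : ℂ) (he : ∀ m : ℕ, 1 + a - b ≠ -(m : ℂ))
    (hf : ∀ m : ℕ, 1 + a - c ≠ -(m : ℂ)) {z : ℂ} (hz : ‖z‖ < 1 / 32) :
    hypF [a, b, c] [1 + a - b, 1 + a - c] z = (1 - z) ^ (-a) *
      hypF [a / 2, (a + 1) / 2, 1 + a - b - c] [1 + a - b, 1 + a - c]
        (-4 * z / (1 - z) ^ 2) := by
  set g := coeffThreeTwo (a / 2) ((a + 1) / 2) (1 + a - b - c) (1 + a - b) (1 + a - c) with hg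
  have hz1 : ‖z‖ < 1 := hz.trans (by norm_num)
  have hz0 : 1 - z ≠ 0 := fun h => by
    rw [← sub_eq_zero.mp h] at hz1
    simp at hz1
  obtain ⟨N, hN⟩ := exists_nat_ge ‖a‖
  have hgs : Summable fun k => ‖g k‖ * (1 / 2 : ℝ) ^ k :=
    summable_norm_mul_pow (summable_coeffThreeTwo _ _ _ he hf) (by norm_num) (by norm_num)
  let T : ℕ × ℕ → ℂ := fun p =>
    g p.1 * (-4) ^ p.1 * (poch (a + 2 * p.1) p.2 / p.2.factorial) * z ^ (p.1 + p.2)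
  have hT : Summable T := by
    have hgeo : Summable fun j : ℕ => (2 : ℝ) ^ N * (2 * ‖z‖) ^ j :=
      (summable_geometric_of_lt_one (by positivity) (by linarith)).mul_left _
    refine Summable.of_norm_bounded (hgs.mul_of_nonneg hgeo (fun k => by positivity)
      (fun j => by positivity)) fun p => ?_
    have h16 : (16 * ‖z‖) ^ p.1 ≤ (1 / 2 : ℝ) ^ p.1 := by
      gcongr
      linarith
    calc ‖T p‖ = ‖g p.1‖ * 4 ^ p.1 * ‖poch (a + 2 * p.1) p.2 / p.2.factorial‖ *
          ‖z‖ ^ (p.1 + p.2) := by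
            simp only [T, norm_mul, norm_pow, norm_neg, Complex.norm_ofNat]
      _ ≤ ‖g p.1‖ * 4 ^ p.1 * 2 ^ (N + 2 * p.1 + p.2) * ‖z‖ ^ (p.1 + p.2) := by
            gcongr
            exact norm_poch_div_factorial_le a hN p.1 p.2
      _ = ‖g p.1‖ * (16 * ‖z‖) ^ p.1 * (2 ^ N * (2 * ‖z‖) ^ p.2) := by
            rw [show (16 : ℝ) = 4 * 2 ^ 2 by norm_num]
            simp only [mul_pow, pow_add, pow_mul]
            ring
      _ ≤ _ := by gcongr
  have hrow : ∀ k : ℕ, HasSum (fun j => T (k, j))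
      ((1 - z) ^ (-a) * (g k * (-4 * z / (1 - z) ^ 2) ^ k)) := by
    intro k
    convert! (hasSum_binomial (a + 2 * k) hz1).mul_left (g k * (-4 * z) ^ k) using 1
    · funext j
      simp only [T, mul_pow, pow_add]
      ring
    · rw [neg_add, Complex.cpow_add _ _ hz0, Complex.cpow_neg _ (2 * k),
        show (2 * k : ℂ) = ((2 * k : ℕ) : ℂ) by push_cast; ring, Complex.cpow_natCast, pow_mul,
        div_pow]
      ring
  have hdiag : HasSum (fun n => coeffThreeTwo a b c (1 + a - b) (1 + a - c) n * z ^ n)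
      (∑' p, T p) := by
    have h := (Finset.HasAntidiagonal.sigmaAntidiagonalEquivProd (A := ℕ)).hasSum_iff.mpr hT.hasSum
    refine h.sigma fun n => ?_
    rw [← whipple_coeff a b c he hf n, sum_mul, ← sum_attach]
    convert hasSum_fintype _ using 1
    rw [univ_eq_attach]
    refine sum_congr rfl fun p _ => ?_
    have hp : p.1.1 + p.1.2 = n := mem_antidiagonal.mp p.2
    simp [T, hg, hp]
  rw [hypF_three_two, hypF_three_two]
  simp only
  rw [hdiag.tsum_eq, ← tsum_mul_left]
  exact (hT.hasSum.prod_fiberwise hrow).tsum_eq.symm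

theorem abs_lt_one_of_mem {x : ℝ} (hx : x ∈ Set.Ioo (-1) (3 - 2 * Real.sqrt 2)) : |x| < 1 := by
  have h : (1 : ℝ) < Real.sqrt 2 := by
    rw [Real.lt_sqrt] <;> norm_num
  exact abs_lt.mpr ⟨hx.1, by linarith [hx.2]⟩

theorem norm_quadratic_lt_one {x : ℝ} (hx : x ∈ Set.Ioo (-1) (3 - 2 * Real.sqrt 2)) :
    ‖(-4 * (x : ℂ) / (1 - (x : ℂ)) ^ 2)‖ < 1 := by
  have h1 := (abs_lt.mp (abs_lt_one_of_mem hx)).2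
  have h2 : 0 < (1 - x) ^ 2 := pow_pos (by linarith) 2
  have hs : Real.sqrt 2 ^ 2 = 2 := Real.sq_sqrt (by norm_num)
  have hs0 := Real.sqrt_nonneg 2
  have hr : (-4 * (x : ℂ) / (1 - (x : ℂ)) ^ 2) = ((-4 * x / (1 - x) ^ 2 : ℝ) : ℂ) := by
    push_cast
    ring
  rw [hr, Complex.norm_real, Real.norm_eq_abs, abs_div, abs_of_pos h2, div_lt_one h2, abs_lt]
  constructor
  · nlinarith [mul_pos (sub_pos.mpr hx.2) (show 0 < 3 + 2 * Real.sqrt 2 - x by linarith)]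
  · nlinarith [pow_pos (show 0 < 1 + x by linarith [hx.1]) 2]

theorem one_sub_mem_slitPlane {x : ℝ} (hx : x < 1) : 1 - (x : ℂ) ∈ Complex.slitPlane := by
  have : 1 - (x : ℂ) = ((1 - x : ℝ) : ℂ) := by push_cast; ring
  rw [this, Complex.ofReal_mem_slitPlane]
  linarith

theorem AnalyticAt.real_of_complex {F : ℂ → ℂ} {x : ℝ} (hF : AnalyticAt ℂ F x) :
    AnalyticAt ℝ (fun y : ℝ => F y) x :=
  (hF.restrictScalars (𝕜 := ℝ)).comp (Complex.ofRealCLM.analyticAt x)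

/-- Whipple's quadratic transformation on the real interval `(-1, 3 - 2√2)`. -/
theorem whipple_eqOn (a b c : ℂ) (he : ∀ m : ℕ, 1 + a - b ≠ -(m : ℂ))
    (hf : ∀ m : ℕ, 1 + a - c ≠ -(m : ℂ)) :
    Set.EqOn (fun x : ℝ => hypF [a, b, c] [1 + a - b, 1 + a - c] (x : ℂ))
      (fun x : ℝ => (1 - (x : ℂ)) ^ (-a) *
        hypF [a / 2, (a + 1) / 2, 1 + a - b - c] [1 + a - b, 1 + a - c]
          (-4 * (x : ℂ) / (1 - (x : ℂ)) ^ 2))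
      (Set.Ioo (-1) (3 - 2 * Real.sqrt 2)) := by
  have h0 : (0 : ℝ) < 3 - 2 * Real.sqrt 2 := by
    have : Real.sqrt 2 < 3 / 2 := by
      rw [Real.sqrt_lt'] <;> norm_num
    linarith
  refine AnalyticOnNhd.eqOn_of_preconnected_of_eventuallyEq (𝕜 := ℝ) (z₀ := 0) (fun x hx => ?_)
    (fun x hx => ?_) isPreconnected_Ioo ⟨by norm_num, h0⟩ ?_
  · exact (analyticAt_hypF_three_two a b c he hf (by simpa using abs_lt_one_of_mem hx)).real_of_complex
  · have h1 := one_sub_mem_slitPlane (abs_lt.mp (abs_lt_one_of_mem hx)).2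
    have hne : (1 - (x : ℂ)) ^ 2 ≠ 0 := pow_ne_zero 2 (Complex.slitPlane_ne_zero h1)
    refine AnalyticAt.real_of_complex (F := fun z : ℂ => (1 - z) ^ (-a) *
      hypF [a / 2, (a + 1) / 2, 1 + a - b - c] [1 + a - b, 1 + a - c] (-4 * z / (1 - z) ^ 2)) ?_
    refine AnalyticAt.mul (AnalyticAt.cpow (by fun_prop) analyticAt_const h1) ?_
    exact (analyticAt_hypF_three_two _ _ _ he hf (norm_quadratic_lt_one hx)).comp_of_eq
      (AnalyticAt.div (by fun_prop) (by fun_prop) hne) rfl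
  · have : ∀ᶠ x : ℝ in 𝓝 0, ‖x‖ < 1 / 32 :=
      (continuous_norm.tendsto' (0 : ℝ) 0 norm_zero).eventually_lt_const (by norm_num)
    filter_upwards [this] with x hx
    exact whipple_of_norm_lt a b c he hf (by simpa using hx)

theorem deriv_whipple (a b c : ℂ) (he : ∀ m : ℕ, 1 + a - b ≠ -(m : ℂ))
    (hf : ∀ m : ℕ, 1 + a - c ≠ -(m : ℂ)) {x : ℝ}
    (hx : x ∈ Set.Ioo (-1) (3 - 2 * Real.sqrt 2)) :
    deriv (hypF [a, b, c] [1 + a - b, 1 + a - c]) (x : ℂ) =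
      a * (1 - (x : ℂ)) ^ (-a - 1) *
        hypF [a / 2, (a + 1) / 2, 1 + a - b - c] [1 + a - b, 1 + a - c]
          (-4 * (x : ℂ) / (1 - (x : ℂ)) ^ 2) +
      (1 - (x : ℂ)) ^ (-a) *
        (deriv (hypF [a / 2, (a + 1) / 2, 1 + a - b - c] [1 + a - b, 1 + a - c])
          (-4 * (x : ℂ) / (1 - (x : ℂ)) ^ 2) * (-4 * (1 + x) / (1 - x) ^ 3)) := by
  have h1 := one_sub_mem_slitPlane (abs_lt.mp (abs_lt_one_of_mem hx)).2
  have hne : 1 - (x : ℂ) ≠ 0 := Complex.slitPlane_ne_zero h1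
  have hF := (analyticAt_hypF_three_two a b c he hf (z := x)
    (by simpa using abs_lt_one_of_mem hx)).differentiableAt.hasDerivAt.comp_ofReal
  have hG := (analyticAt_hypF_three_two (a / 2) ((a + 1) / 2) (1 + a - b - c) he hf
    (norm_quadratic_lt_one hx)).differentiableAt.hasDerivAt
  have hsub : HasDerivAt (fun z : ℂ => 1 - z) (-1) (x : ℂ) := (hasDerivAt_id _).const_sub 1
  have hy : HasDerivAt (fun z : ℂ => -4 * z / (1 - z) ^ 2) (-4 * (1 + (x : ℂ)) / (1 - x) ^ 3)
      (x : ℂ) := by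
    convert! ((hasDerivAt_id (x : ℂ)).const_mul (-4)).div (hsub.pow 2) (pow_ne_zero 2 hne) using 1
    simp only [id, Pi.pow_apply, Nat.cast_ofNat]
    field_simp
    ring
  have hR := ((hsub.cpow_const (c := -a) h1).mul (hG.comp (x : ℂ) hy)).comp_ofReal
  have hev := (whipple_eqOn a b c he hf).eventuallyEq_of_mem (isOpen_Ioo.mem_nhds hx)
  rw [hF.unique (hR.congr_of_eventuallyEq hev)]
  simp only [Function.comp]
  ring

theorem corollary_2C6P1 (a b c q : ℂ) (hq : q ≠ 0)
    (hnd : ∀ z ∈ [1 + a - b, 1 + a - c, q], ∀ m : ℕ, z ≠ -(m : ℂ))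
    (x : ℝ) (hx1 : -1 < x) (hx2 : x < 3 - 2 * Real.sqrt 2)
    (δ : ℂ) (hδ : δ = (q + (a - q) * (x : ℂ)) / (1 + (x : ℂ)))
    (hδn : ∀ m : ℕ, δ ≠ -(m : ℂ)) :
    hypSummable [a, b, c, q + 1] [1 + a - b, 1 + a - c, q] (x : ℂ) ∧
    hypSummable [a / 2, (a + 1) / 2, 1 + a - b - c, δ + 1] [1 + a - b, 1 + a - c, δ]
        (-4 * (x : ℂ) / (1 - (x : ℂ)) ^ 2) ∧
    hypF [a, b, c, q + 1] [1 + a - b, 1 + a - c, q] (x : ℂ)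
      = (1 + (a - q) / q * (x : ℂ)) * (1 - (x : ℂ)) ^ (-a - 1) *
        hypF [a / 2, (a + 1) / 2, 1 + a - b - c, δ + 1] [1 + a - b, 1 + a - c, δ]
          (-4 * (x : ℂ) / (1 - (x : ℂ)) ^ 2) := by
  have he := hnd (1 + a - b) (by simp)
  have hf := hnd (1 + a - c) (by simp)
  have hqn := hnd q (by simp)
  have hx : x ∈ Set.Ioo (-1) (3 - 2 * Real.sqrt 2) := ⟨hx1, hx2⟩
  have hL := hasSum_four_three a b c he hf hqn (z := x) (by simpa using abs_lt_one_of_mem hx)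
  have hR := hasSum_four_three (a / 2) ((a + 1) / 2) (1 + a - b - c) he hf hδn
    (norm_quadratic_lt_one hx)
  refine ⟨hL.summable, hR.summable, ?_⟩
  have h1x : (1 : ℂ) - x ≠ 0 := Complex.slitPlane_ne_zero
    (one_sub_mem_slitPlane (abs_lt.mp (abs_lt_one_of_mem hx)).2)
  have h1x' : (1 : ℂ) + x ≠ 0 := by
    exact_mod_cast (by linarith : 1 + x ≠ 0)
  have hδ0 : q + x * (a - q) ≠ 0 := fun h => hδn 0 (by simp [hδ, mul_comm _ (x : ℂ), h])
  have hpow : (1 - (x : ℂ)) ^ (-a) = (1 - (x : ℂ)) ^ (-a - 1) * (1 - x) := by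
    rw [Complex.cpow_sub _ _ h1x, Complex.cpow_one, div_mul_cancel₀ _ h1x]
  have hW := whipple_eqOn a b c he hf hx
  simp only at hW
  rw [show hypF [a, b, c, q + 1] _ _ = _ from hL.tsum_eq,
    show hypF [a / 2, (a + 1) / 2, 1 + a - b - c, δ + 1] _ _ = _ from hR.tsum_eq, hW, deriv_whipple a b c he hf hx,
    hpow, hδ]
  generalize (1 - (x : ℂ)) ^ (-a - 1) = P
  generalize hypF [a / 2, (a + 1) / 2, 1 + a - b - c] [1 + a - b, 1 + a - c]
    (-4 * (x : ℂ) / (1 - (x : ℂ)) ^ 2) = G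
  generalize deriv (hypF [a / 2, (a + 1) / 2, 1 + a - b - c] [1 + a - b, 1 + a - c])
    (-4 * (x : ℂ) / (1 - (x : ℂ)) ^ 2) = G'
  field_simp
  ring
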